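/- arXiv:1211.2451 — 6 statements merged into one kernel-verified Lean document; each statement's English description precedes it below -/
import Mathlib

section
/- Let κ, p ∈ ℝ and α ∈ ℝ. Then for all z in the unit disk 𝔻, 𝒫(∂)φ_α = A(α)φ_α + B(α)φ_{α−1} + C(α)φ_{α−2}, where A(α) = −(κ/2)α² + α + p, B(α) = (κ/2)α(2α−1) − 3α, C(α) = −(κ/2)α(α−1) + 2α − p, and moreover A(α) + B(α) + C(α) = 0. Furthermore, for κ > 0 the unique pair (α, p) with α ≠ 0 satisfying A(α) = 0 and B(α) = 0 is α = (6+κ)/(2κ), p = (6+κ)(2+κ)/(8κ); for these values 𝒫(∂)φ_α = 0 on 𝔻. -/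
open Complex Metric

/-- `φ_α(z) = (1−z)^α` (principal branch). -/
noncomputable def phi (α : ℝ) : ℂ → ℂ := fun z => (1 - z) ^ (α : ℂ)

/-- The boundary operator `𝒫(∂)`:
`𝒫(∂)f = −(κ/2)(z d/dz)² f + ((z+1)/(z−1)) z f' − p(1/(z−1)² − 1) f`. -/
noncomputable def Pbnd (κ p : ℝ) (f : ℂ → ℂ) : ℂ → ℂ :=
  fun z => -((κ : ℂ)/2) * (z * deriv (fun t => t * deriv f t) z)
    + ((z + 1)/(z - 1)) * (z * deriv f z)
    - (p : ℂ) * (1/(z - 1)^2 - 1) * f z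

/-- `A(α) = −(κ/2)α² + α + p`. -/
noncomputable def Acoef (κ p α : ℝ) : ℝ := -(κ/2) * α^2 + α + p

/-- `B(α) = (κ/2)α(2α−1) − 3α`. -/
noncomputable def Bcoef (κ α : ℝ) : ℝ := (κ/2) * α * (2*α - 1) - 3*α

/-- `C(α) = −(κ/2)α(α−1) + 2α − p`. -/
noncomputable def Ccoef (κ p α : ℝ) : ℝ := -(κ/2) * α * (α - 1) + 2*α - p

lemma one_sub_mem_slitPlane {z : ℂ} (hz : z ∈ ball (0 : ℂ) 1) : 1 - z ∈ slitPlane := by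
  rw [mem_ball_zero_iff] at hz
  left
  have := (re_le_norm z).trans_lt hz
  simpa using this

lemma phi_sub_one (α : ℝ) {z : ℂ} (hz : 1 - z ≠ 0) : phi (α - 1) z = phi α z / (1 - z) := by
  simp only [phi]
  push_cast
  rw [cpow_sub _ _ hz, cpow_one]

lemma hasDerivAt_phi (α : ℝ) {z : ℂ} (hz : z ∈ ball (0 : ℂ) 1) :
    HasDerivAt (phi α) (-(α : ℂ) * phi (α - 1) z) z := by
  have h := ((hasDerivAt_id z).const_sub 1).cpow_const (c := (α : ℂ))
    (one_sub_mem_slitPlane hz)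
  convert h using 1
  · rfl
  · simp [phi]

/-- The Euler operator `z d/dz` sends `φ_α` to `α (φ_α - φ_{α-1})`. -/
lemma mul_deriv_phi (α : ℝ) {z : ℂ} (hz : z ∈ ball (0 : ℂ) 1) :
    z * deriv (phi α) z = α * (phi α z - phi (α - 1) z) := by
  have h0 : 1 - z ≠ 0 := slitPlane_ne_zero (one_sub_mem_slitPlane hz)
  rw [(hasDerivAt_phi α hz).deriv, phi_sub_one α h0]
  field_simp
  ring

lemma mul_deriv_mul_deriv_phi (α : ℝ) {z : ℂ} (hz : z ∈ ball (0 : ℂ) 1) :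
    z * deriv (fun t => t * deriv (phi α) t) z =
      α * (α * (phi α z - phi (α - 1) z) - (α - 1) * (phi (α - 1) z - phi (α - 2) z)) := by
  have heq : (fun t => t * deriv (phi α) t) =ᶠ[nhds z]
      fun t => (α : ℂ) * (phi α t - phi (α - 1) t) := by
    filter_upwards [isOpen_ball.mem_nhds hz] with t ht using mul_deriv_phi α ht
  have hd := ((hasDerivAt_phi α hz).sub (hasDerivAt_phi (α - 1) hz)).const_mul (α : ℂ)
  have h1 := mul_deriv_phi α hz
  have h2 := mul_deriv_phi (α - 1) hz
  rw [(hasDerivAt_phi _ hz).deriv] at h1 h2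
  have h3 : α - 1 - 1 = α - 2 := by ring
  rw [h3] at h2 hd
  rw [heq.deriv_eq, HasDerivAt.deriv (f := fun t => (α : ℂ) * (phi α t - phi (α - 1) t)) hd]
  push_cast at h2 ⊢
  linear_combination (α : ℂ) * h1 - (α : ℂ) * h2

lemma Pbnd_phi (κ p α : ℝ) {z : ℂ} (hz : z ∈ ball (0 : ℂ) 1) :
    Pbnd κ p (phi α) z =
      (Acoef κ p α : ℂ) * phi α z + (Bcoef κ α : ℂ) * phi (α - 1) z
        + (Ccoef κ p α : ℂ) * phi (α - 2) z := by
  have h0 : 1 - z ≠ 0 := slitPlane_ne_zero (one_sub_mem_slitPlane hz)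
  have h1 : z - 1 ≠ 0 := by rw [← neg_sub]; exact neg_ne_zero.mpr h0
  have h2 : phi (α - 2) z = phi α z / (1 - z) / (1 - z) := by
    rw [← phi_sub_one α h0, ← phi_sub_one (α - 1) h0]
    ring_nf
  have h3 : (z + 1) / (z - 1) = 1 - 2 / (1 - z) := by
    field_simp
    ring
  have h4 : 1 / (z - 1) ^ 2 = 1 / (1 - z) ^ 2 := by rw [← neg_sub, neg_sq]
  simp only [Pbnd, Acoef, Bcoef, Ccoef]
  rw [mul_deriv_mul_deriv_phi α hz, mul_deriv_phi α hz, h2, phi_sub_one α h0, h3, h4]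
  push_cast
  field_simp
  ring

lemma Acoef_Bcoef_eq_zero_iff {κ : ℝ} (hκ : 0 < κ) (p : ℝ) {α : ℝ} (hα : α ≠ 0) :
    Acoef κ p α = 0 ∧ Bcoef κ α = 0 ↔
      α = (6 + κ) / (2 * κ) ∧ p = (6 + κ) * (2 + κ) / (8 * κ) := by
  have hB : Bcoef κ α = 0 ↔ α = (6 + κ) / (2 * κ) := by
    have : Bcoef κ α = α / 2 * (α * (2 * κ) - (6 + κ)) := by
      simp only [Bcoef]
      ring
    rw [this, eq_div_iff (by positivity), mul_eq_zero, sub_eq_zero]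
    simp [hα]
  rw [hB, and_comm]
  refine and_congr_right fun h => ?_
  have : Acoef κ p α = p - (6 + κ) * (2 + κ) / (8 * κ) := by
    simp only [Acoef, h]
    field_simp
    ring
  rw [this, sub_eq_zero]

/-- `𝒫(∂)φ_α = A(α)φ_α + B(α)φ_{α−1} + C(α)φ_{α−2}` on `𝔻`, with `A + B + C = 0`;
for `κ > 0` the unique pair `(α,p)` with `α ≠ 0`, `A(α) = 0` and `B(α) = 0` is
`α = (6+κ)/(2κ)`, `p = (6+κ)(2+κ)/(8κ)`, and for these values `𝒫(∂)φ_α = 0` on `𝔻`. -/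
theorem stmt2 (κ p α : ℝ) :
    (∀ z ∈ ball (0:ℂ) 1,
      Pbnd κ p (phi α) z =
        (Acoef κ p α : ℂ) * phi α z + (Bcoef κ α : ℂ) * phi (α - 1) z
          + (Ccoef κ p α : ℂ) * phi (α - 2) z) ∧
    Acoef κ p α + Bcoef κ α + Ccoef κ p α = 0 ∧
    (0 < κ →
      (∀ α' p' : ℝ, α' ≠ 0 →
        (Acoef κ p' α' = 0 ∧ Bcoef κ α' = 0 ↔
          α' = (6 + κ)/(2*κ) ∧ p' = (6 + κ)*(2 + κ)/(8*κ))) ∧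
      (∀ z ∈ ball (0:ℂ) 1,
        Pbnd κ ((6 + κ)*(2 + κ)/(8*κ)) (phi ((6 + κ)/(2*κ))) z = 0)) := by
  refine ⟨fun z hz => Pbnd_phi κ p α hz, by simp only [Acoef, Bcoef, Ccoef]; ring, fun hκ =>
    ⟨fun α' p' hα' => Acoef_Bcoef_eq_zero_iff hκ p' hα', fun z hz => ?_⟩⟩
  have hα : (6 + κ) / (2 * κ) ≠ 0 := by positivity
  obtain ⟨hA, hB⟩ := (Acoef_Bcoef_eq_zero_iff hκ _ hα).2 ⟨rfl, rfl⟩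
  have hC : Ccoef κ ((6 + κ) * (2 + κ) / (8 * κ)) ((6 + κ) / (2 * κ)) = 0 := by
    simp only [Ccoef]
    field_simp
    ring
  rw [Pbnd_phi _ _ _ hz, hA, hB, hC]
  simp
end

section
/- Let κ > 0, set α = (8+κ)/(3κ), β = κα²/2 = (8+κ)²/(18κ), and p = (8+κ)(2+κ)/(9κ). Then the function F(z,w) = (1−z²)^α (1−w²)^α (1−z²w²)^{−β} (principal-branch powers, well defined since 1−z², 1−w², 1−z²w² all have positive real part on 𝔻 × 𝔻) satisfies on 𝔻 × 𝔻 the oddified Beliaev–Smirnov equation −(κ/4)(z∂_z − w∂_w)²F + ((z²+1)/(z²−1))·z∂_zF + ((w²+1)/(w²−1))·w∂_wF + p(1/(1−z²) + 1/(1−w²) − 2/(1−z²)² − 2/(1−w²)² + 2)F = 0. (This is the analytic content of the theorem that the oddified whole-plane SLE_κ map h₀(z) = z√(f₀(z²)/z²) has E[|h₀'(z)|^p] = (1−z²)^α(1−z̄²)^α(1−z²z̄²)^{−β} for this special exponent p.) -/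
open Complex Metric Set

/-- `z ∂_z` acting on functions of two complex variables. -/
noncomputable def dZ (F : ℂ → ℂ → ℂ) : ℂ → ℂ → ℂ :=
  fun z w => z * deriv (fun t => F t w) z

/-- `w ∂_w` acting on functions of two complex variables. -/
noncomputable def dW (F : ℂ → ℂ → ℂ) : ℂ → ℂ → ℂ :=
  fun z w => w * deriv (fun t => F z t) w

/-- The oddified Beliaev–Smirnov operator:
`−(κ/4)(z∂_z − w∂_w)²F + ((z²+1)/(z²−1)) z∂_zF + ((w²+1)/(w²−1)) w∂_wF
  + p(1/(1−z²) + 1/(1−w²) − 2/(1−z²)² − 2/(1−w²)² + 2)F`. -/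
noncomputable def BSodd (κ p : ℝ) (F : ℂ → ℂ → ℂ) : ℂ → ℂ → ℂ :=
  fun z w =>
    -((κ : ℂ)/4) * (dZ (fun u v => dZ F u v - dW F u v) z w
        - dW (fun u v => dZ F u v - dW F u v) z w)
      + ((z^2 + 1)/(z^2 - 1)) * dZ F z w
      + ((w^2 + 1)/(w^2 - 1)) * dW F z w
      + (p : ℂ) * (1/(1 - z^2) + 1/(1 - w^2)
          - 2/(1 - z^2)^2 - 2/(1 - w^2)^2 + 2) * F z w

theorem one_sub_mem_slitPlane_s4 {x : ℂ} (hx : ‖x‖ < 1) : 1 - x ∈ slitPlane := by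
  refine mem_slitPlane_iff.2 (Or.inl ?_)
  have := (re_le_norm x).trans_lt hx
  simpa using this

theorem norm_sq_mul_sq_lt_one {z w : ℂ} (hz : ‖z‖ < 1) (hw : ‖w‖ < 1) : ‖z ^ 2 * w ^ 2‖ < 1 := by
  rw [← mul_pow, norm_pow, norm_mul]
  exact pow_lt_one₀ (by positivity)
    (mul_lt_one_of_nonneg_of_lt_one_left (norm_nonneg _) hz hw.le) two_ne_zero

theorem norm_sq_lt_one {z : ℂ} (hz : ‖z‖ < 1) : ‖z ^ 2‖ < 1 := by
  rw [norm_pow]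
  exact pow_lt_one₀ (norm_nonneg _) hz two_ne_zero

theorem hasDerivAt_one_sub_sq_mul_cpow (a s : ℂ) {z : ℂ} (h : 1 - z ^ 2 * s ∈ slitPlane) :
    HasDerivAt (fun t : ℂ => (1 - t ^ 2 * s) ^ a)
      ((1 - z ^ 2 * s) ^ a * (-(2 * a * z * s) / (1 - z ^ 2 * s))) z := by
  have h0 : HasDerivAt (fun t : ℂ => 1 - t ^ 2 * s) (-(2 * z * s)) z := by
    simpa using ((hasDerivAt_pow 2 z).mul_const s).const_sub 1
  convert h0.cpow_const (c := a) h using 1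
  rw [cpow_sub _ _ (slitPlane_ne_zero h), cpow_one]
  ring

theorem hasDerivAt_cpow_product (a b : ℂ) {z w : ℂ} (hz : ‖z‖ < 1) (hw : ‖w‖ < 1) :
    HasDerivAt (fun t : ℂ => (1 - t ^ 2) ^ a * (1 - w ^ 2) ^ a * (1 - t ^ 2 * w ^ 2) ^ b)
      ((1 - z ^ 2) ^ a * (1 - w ^ 2) ^ a * (1 - z ^ 2 * w ^ 2) ^ b *
        (-(2 * a * z) / (1 - z ^ 2) - 2 * b * z * w ^ 2 / (1 - z ^ 2 * w ^ 2))) z := by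
  have h1 := hasDerivAt_one_sub_sq_mul_cpow a 1 (z := z)
    (by simpa using one_sub_mem_slitPlane_s4 (norm_sq_lt_one hz))
  have h2 := hasDerivAt_one_sub_sq_mul_cpow b (w ^ 2)
    (one_sub_mem_slitPlane_s4 (norm_sq_mul_sq_lt_one hz hw))
  simp only [mul_one] at h1
  refine ((h1.mul_const ((1 - w ^ 2) ^ a)).mul h2).congr_deriv ?_
  ring

theorem hasDerivAt_sq_div_one_sub_sq {z : ℂ} (h : 1 - z ^ 2 ≠ 0) :
    HasDerivAt (fun t : ℂ => t ^ 2 / (1 - t ^ 2)) (2 * z / (1 - z ^ 2) ^ 2) z := by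
  have h1 : HasDerivAt (fun t : ℂ => t ^ 2) (2 * z) z := by simpa using hasDerivAt_pow 2 z
  refine (h1.div (h1.const_sub 1) h).congr_deriv ?_
  ring

/-- For `κ > 0`, `α = (8+κ)/(3κ)`, `β = κα²/2 = (8+κ)²/(18κ)`, `p = (8+κ)(2+κ)/(9κ)`,
the function `F(z,w) = (1−z²)^α (1−w²)^α (1−z²w²)^{−β}` satisfies the oddified
Beliaev–Smirnov equation on `𝔻 × 𝔻`. -/
theorem stmt4 (κ : ℝ) (hκ : 0 < κ) :
    let α : ℝ := (8 + κ)/(3*κ)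
    let β : ℝ := κ * α^2/2
    let p : ℝ := (8 + κ)*(2 + κ)/(9*κ)
    let F : ℂ → ℂ → ℂ := fun u v =>
      (1 - u^2) ^ (α : ℂ) * (1 - v^2) ^ (α : ℂ) * (1 - u^2*v^2) ^ (-(β : ℂ))
    ∀ z ∈ ball (0:ℂ) 1, ∀ w ∈ ball (0:ℂ) 1, BSodd κ p F z w = 0 := by
  intro α β p F z hz w hw
  have hk : (κ : ℂ) ≠ 0 := by exact_mod_cast hκ.ne'
  have hα : (α : ℂ) = (8 + κ) / (3 * κ) := by simp [α]
  have hβ : (β : ℂ) = κ * (α : ℂ) ^ 2 / 2 := by simp [β]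
  have hp : (p : ℂ) = (8 + κ) * (2 + κ) / (9 * κ) := by simp [p]
  have F_comm : ∀ u v, F u v = F v u := fun u v => by
    simp only [F, mul_comm (u ^ 2) (v ^ 2), mul_comm ((1 - u ^ 2) ^ (α : ℂ))]
  have ne : ∀ u ∈ ball (0 : ℂ) 1, 1 - u ^ 2 ≠ 0 := fun u hu =>
    slitPlane_ne_zero (one_sub_mem_slitPlane_s4 (norm_sq_lt_one (mem_ball_zero_iff.1 hu)))
  have ne' : ∀ u ∈ ball (0 : ℂ) 1, ∀ v ∈ ball (0 : ℂ) 1, 1 - u ^ 2 * v ^ 2 ≠ 0 :=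
    fun u hu v hv => slitPlane_ne_zero (one_sub_mem_slitPlane_s4
      (norm_sq_mul_sq_lt_one (mem_ball_zero_iff.1 hu) (mem_ball_zero_iff.1 hv)))
  have hF₁ : ∀ u ∈ ball (0 : ℂ) 1, ∀ v ∈ ball (0 : ℂ) 1, HasDerivAt (fun t => F t v)
      (F u v * (-(2 * α * u) / (1 - u ^ 2) + 2 * β * u * v ^ 2 / (1 - u ^ 2 * v ^ 2))) u := by
    intro u hu v hv
    convert hasDerivAt_cpow_product α (-β) (mem_ball_zero_iff.1 hu) (mem_ball_zero_iff.1 hv) using 1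
    ring
  have hF₂ : ∀ u ∈ ball (0 : ℂ) 1, ∀ v ∈ ball (0 : ℂ) 1, HasDerivAt (fun t => F u t)
      (F u v * (-(2 * α * v) / (1 - v ^ 2) + 2 * β * v * u ^ 2 / (1 - u ^ 2 * v ^ 2))) v := by
    intro u hu v hv
    rw [F_comm u v, mul_comm (u ^ 2) (v ^ 2)]
    simpa only [F_comm u] using hF₁ v hv u hu
  have hZ : ∀ u ∈ ball (0 : ℂ) 1, ∀ v ∈ ball (0 : ℂ) 1, dZ F u v = F u v *
      (-(2 * α * u ^ 2) / (1 - u ^ 2) + 2 * β * u ^ 2 * v ^ 2 / (1 - u ^ 2 * v ^ 2)) := by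
    intro u hu v hv
    rw [dZ, (hF₁ u hu v hv).deriv]
    ring
  have hW : ∀ u ∈ ball (0 : ℂ) 1, ∀ v ∈ ball (0 : ℂ) 1, dW F u v = F u v *
      (-(2 * α * v ^ 2) / (1 - v ^ 2) + 2 * β * u ^ 2 * v ^ 2 / (1 - u ^ 2 * v ^ 2)) := by
    intro u hu v hv
    rw [dW, (hF₂ u hu v hv).deriv]
    ring
  have hD : ∀ u ∈ ball (0 : ℂ) 1, ∀ v ∈ ball (0 : ℂ) 1, dZ F u v - dW F u v =
      F u v * (2 * α * (v ^ 2 / (1 - v ^ 2) - u ^ 2 / (1 - u ^ 2))) := by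
    intro u hu v hv
    rw [hZ u hu v hv, hW u hu v hv]
    ring
  have hDZ : dZ (fun u v => dZ F u v - dW F u v) z w =
      dZ F z w * (2 * α * (w ^ 2 / (1 - w ^ 2) - z ^ 2 / (1 - z ^ 2))) +
        F z w * (2 * α * -(2 * z ^ 2 / (1 - z ^ 2) ^ 2)) := by
    have e : (fun t => dZ F t w - dW F t w) =ᶠ[nhds z] fun t =>
        F t w * (2 * α * (w ^ 2 / (1 - w ^ 2) - t ^ 2 / (1 - t ^ 2))) := by
      filter_upwards [isOpen_ball.mem_nhds hz] with t ht using hD t ht w hw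
    have h := (hF₁ z hz w hw).mul (((hasDerivAt_sq_div_one_sub_sq (ne z hz)).const_sub
      (w ^ 2 / (1 - w ^ 2))).const_mul (2 * (α : ℂ)))
    rw [hZ z hz w hw, dZ, (h.congr_of_eventuallyEq e).deriv]
    ring
  have hDW : dW (fun u v => dZ F u v - dW F u v) z w =
      dW F z w * (2 * α * (w ^ 2 / (1 - w ^ 2) - z ^ 2 / (1 - z ^ 2))) +
        F z w * (2 * α * (2 * w ^ 2 / (1 - w ^ 2) ^ 2)) := by
    have e : (fun t => dZ F z t - dW F z t) =ᶠ[nhds w] fun t =>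
        F z t * (2 * α * (t ^ 2 / (1 - t ^ 2) - z ^ 2 / (1 - z ^ 2))) := by
      filter_upwards [isOpen_ball.mem_nhds hw] with t ht using hD z hz t ht
    have h := (hF₂ z hz w hw).mul (((hasDerivAt_sq_div_one_sub_sq (ne w hw)).sub_const
      (z ^ 2 / (1 - z ^ 2))).const_mul (2 * (α : ℂ)))
    rw [hW z hz w hw, dW, (h.congr_of_eventuallyEq e).deriv]
    ring
  have hz' := ne z hz
  have hw' := ne w hw
  have hzw := ne' z hz w hw
  rw [BSodd, hDZ, hDW, hZ z hz w hw, hW z hz w hw, hp, hβ, hα,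
    ← neg_sub 1 (z ^ 2), ← neg_sub 1 (w ^ 2)]
  generalize F z w = f
  generalize z ^ 2 = x at *
  generalize w ^ 2 = y at *
  field_simp
  ring
end

section
/- Let κ > 0 and define p*(κ) = (1/(16κ))((4+κ)² − 4 − 2√(2(4+κ)² + 4)). Then 0 < p*(κ) < 3(4+κ)²/(32κ) (in particular (4+κ)² − 8κ·p*(κ) > 0, so the quantities below are real), and at p = p*(κ) one has simultaneously β₀(p*(κ)) = β₊(p*(κ)) and γ₀(p*(κ)) + γ₊(p*(κ)) = 2/κ + 1/2, where γ₀(p) = (1/(2κ))(4+κ − √((4+κ)² − 8κp)), β₀(p) = (κ/2)γ₀(p)², γ₊(p) = (1/κ)(1 + √(1+2κp)), and β₊(p) = 3p − 1/2 − (1/2)√(1+2κp). -/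
/-- For `κ > 0` and `p*(κ) = ((4+κ)² − 4 − 2√(2(4+κ)² + 4))/(16κ)`:
`0 < p*(κ) < 3(4+κ)²/(32κ)` (in particular `(4+κ)² − 8κp*(κ) > 0`), and at `p = p*(κ)`
one has `β₀(p*) = β₊(p*)` and `γ₀(p*) + γ₊(p*) = 2/κ + 1/2`, where
`γ₀(p) = (4+κ − √((4+κ)² − 8κp))/(2κ)`, `β₀(p) = (κ/2)γ₀(p)²`,
`γ₊(p) = (1 + √(1+2κp))/κ`, `β₊(p) = 3p − 1/2 − (1/2)√(1+2κp)`. -/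
theorem stmt9 (κ : ℝ) (hκ : 0 < κ) :
    let pstar : ℝ := (1/(16*κ)) * ((4 + κ)^2 - 4 - 2*Real.sqrt (2*(4 + κ)^2 + 4))
    let γ₀ : ℝ → ℝ := fun p => (1/(2*κ)) * (4 + κ - Real.sqrt ((4 + κ)^2 - 8*κ*p))
    let β₀ : ℝ → ℝ := fun p => (κ/2) * (γ₀ p)^2
    let γp : ℝ → ℝ := fun p => (1/κ) * (1 + Real.sqrt (1 + 2*κ*p))
    let βp : ℝ → ℝ := fun p => 3*p - 1/2 - (1/2)*Real.sqrt (1 + 2*κ*p)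
    0 < pstar ∧ pstar < 3*(4 + κ)^2/(32*κ) ∧ 0 < (4 + κ)^2 - 8*κ*pstar ∧
      β₀ pstar = βp pstar ∧ γ₀ pstar + γp pstar = 2/κ + 1/2 := by
  intro pstar γ₀ β₀ γp βp
  obtain ⟨s, hs⟩ : ∃ s, s = Real.sqrt (2*(4 + κ)^2 + 4) := ⟨_, rfl⟩
  have hs2 : s^2 = 2*(4 + κ)^2 + 4 := by rw [hs, Real.sq_sqrt (by positivity)]
  have hs0 : 0 ≤ s := hs ▸ Real.sqrt_nonneg _
  have hs6 : 6 < s := by nlinarith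
  have hp : pstar = (s - 6)*(s + 2)/(32*κ) := by
    simp only [pstar, ← hs]
    field_simp
    linarith
  have hbulk : (4 + κ)^2 - 8*κ*pstar = ((s + 2)/2)^2 := by
    rw [hp]
    field_simp
    linarith
  have hplus : 1 + 2*κ*pstar = ((s - 2)/4)^2 := by
    rw [hp]
    field_simp
    ring
  have hsqrt_bulk : Real.sqrt ((4 + κ)^2 - 8*κ*pstar) = (s + 2)/2 := by
    rw [hbulk, Real.sqrt_sq (by linarith)]
  have hsqrt_plus : Real.sqrt (1 + 2*κ*pstar) = (s - 2)/4 := by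
    rw [hplus, Real.sqrt_sq (by linarith)]
  refine ⟨?_, ?_, ?_, ?_, ?_⟩
  · rw [hp]
    have : 0 < s - 6 := by linarith
    positivity
  · rw [hp]
    rw [div_lt_div_iff_of_pos_right (by positivity)]
    nlinarith
  · rw [hbulk]
    positivity
  · simp only [β₀, γ₀, βp, hsqrt_bulk, hsqrt_plus]
    rw [hp]
    field_simp
    linear_combination (-256) * hs2
  · simp only [γ₀, γp, hsqrt_bulk, hsqrt_plus]
    field_simp
    ring
end

section
/- Let m ≥ 1 be an integer and κ > 0, and assume either m ∈ {1,2,3}, or m ≥ 4 and κ ≤ 4(m+3)/(m−3). Define p_m*(κ) = (m/(8κ(m+1)²))·((m+1)(4+κ)² − 8m − 4√((m+1)(4+κ)² + 4m²)). Then 0 ≤ p_m*(κ) ≤ 3(4+κ)²/(32κ), and B_m(p_m*(κ), κ) = β₀(p_m*(κ), κ), where B_m(p,κ) = (1 + 2/m)p − 1/2 − (1/2)√(1 + 2κp/m) and β₀(p,κ) = −p + ((4+κ)/(4κ))(4+κ − √((4+κ)² − 8κp)). -/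
/-- For an integer `m ≥ 1` and `κ > 0` with either `m ∈ {1,2,3}`, or `m ≥ 4` and
`κ ≤ 4(m+3)/(m−3)`: the phase-transition point
`p_m*(κ) = (m/(8κ(m+1)²))((m+1)(4+κ)² − 8m − 4√((m+1)(4+κ)² + 4m²))` satisfies
`0 ≤ p_m*(κ) ≤ 3(4+κ)²/(32κ)` and `B_m(p_m*(κ),κ) = β₀(p_m*(κ),κ)`, where
`B_m(p,κ) = (1 + 2/m)p − 1/2 − (1/2)√(1 + 2κp/m)` and
`β₀(p,κ) = −p + ((4+κ)/(4κ))(4+κ − √((4+κ)² − 8κp))`. -/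
theorem stmt10 (m : ℕ) (hm : 1 ≤ m) (κ : ℝ) (hκ : 0 < κ)
    (hcase : m ≤ 3 ∨ (4 ≤ m ∧ κ ≤ 4*((m:ℝ) + 3)/((m:ℝ) - 3))) :
    let pm : ℝ := ((m:ℝ)/(8*κ*((m:ℝ) + 1)^2)) *
      (((m:ℝ) + 1)*(4 + κ)^2 - 8*(m:ℝ)
        - 4*Real.sqrt (((m:ℝ) + 1)*(4 + κ)^2 + 4*(m:ℝ)^2))
    let B : ℝ := (1 + 2/(m:ℝ))*pm - 1/2 - (1/2)*Real.sqrt (1 + 2*κ*pm/(m:ℝ))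
    let β₀ : ℝ := -pm + ((4 + κ)/(4*κ))*(4 + κ - Real.sqrt ((4 + κ)^2 - 8*κ*pm))
    0 ≤ pm ∧ pm ≤ 3*(4 + κ)^2/(32*κ) ∧ B = β₀ := by
  have hm0 : (1:ℝ) ≤ m := by exact_mod_cast hm
  have hκm : κ * ((m:ℝ) - 3) ≤ 4 * ((m:ℝ) + 3) := by
    rcases hcase with h | ⟨h, hle⟩
    · have h3 : (m:ℝ) ≤ 3 := by exact_mod_cast h
      nlinarith [mul_nonneg hκ.le (sub_nonneg.2 h3)]
    · have h4 : (4:ℝ) ≤ m := by exact_mod_cast h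
      rwa [le_div_iff₀ (by linarith)] at hle
  clear hcase hm
  generalize (m:ℝ) = x at *
  intro pm B β₀
  have hn : 0 < x + 1 := by linarith
  have hx : 0 < x := by linarith
  obtain ⟨S, hS⟩ : ∃ S, S = Real.sqrt ((x + 1) * (4 + κ)^2 + 4 * x^2) := ⟨_, rfl⟩
  have hSsq : S^2 = (x + 1) * (4 + κ)^2 + 4 * x^2 := by
    rw [hS, Real.sq_sqrt (by positivity)]
  have hS0 : 0 ≤ S := hS ▸ Real.sqrt_nonneg _
  have hSlow : 2 * x + 4 ≤ S := by
    refine (sq_le_sq₀ (by linarith) hS0).1 ?_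
    nlinarith [mul_pos hn hκ, mul_pos (mul_pos hn hκ) hκ]
  have hpm : pm = x / (8 * κ * (x + 1)^2) * ((S - 2 - 2 * (x + 1)) * (S - 2 + 2 * (x + 1))) := by
    simp only [pm, ← hS]
    congr 1
    linear_combination -hSsq
  have hκpm : 8 * κ * pm = x / (x + 1)^2 * ((S - 2)^2 - 4 * (x + 1)^2) := by
    rw [hpm]
    field_simp
    ring
  have hsqB : Real.sqrt (1 + 2 * κ * pm / x) = (S - 2) / (2 * (x + 1)) := by
    rw [← Real.sqrt_sq (show 0 ≤ (S - 2) / (2 * (x + 1)) from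
      div_nonneg (by linarith) (by linarith))]
    congr 1
    rw [show 2 * κ * pm / x = 8 * κ * pm / (4 * x) by ring, hκpm]
    field_simp
    ring
  have hdisc : (4 + κ)^2 - 8 * κ * pm = ((S + 2 * x) / (x + 1))^2 := by
    rw [hκpm]
    field_simp
    linear_combination -(x + 1) * hSsq
  have hsqβ : Real.sqrt ((4 + κ)^2 - 8 * κ * pm) = (S + 2 * x) / (x + 1) := by
    rw [hdisc, Real.sqrt_sq (by positivity)]
  have hSup : (x + 1) * (4 + κ) / 2 - 2 * x ≤ S := by
    rw [hS]
    apply Real.le_sqrt_of_sq_le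
    nlinarith [mul_nonneg (mul_pos hn (show 0 < 4 + κ by linarith)).le (sub_nonneg.2 hκm)]
  refine ⟨?_, ?_, ?_⟩
  · rw [hpm]
    exact mul_nonneg (by positivity) (mul_nonneg (by linarith) (by linarith))
  · have hroot : (4 + κ) / 2 ≤ (S + 2 * x) / (x + 1) := by
      rw [le_div_iff₀ hn]
      linarith
    have hsq := pow_le_pow_left₀ (by positivity) hroot 2
    rw [← hdisc] at hsq
    rw [le_div_iff₀ (by positivity)]
    linarith
  · simp only [B, β₀, hsqB, hsqβ]
    have hpm' : pm = x / (x + 1)^2 * ((S - 2)^2 - 4 * (x + 1)^2) / (8 * κ) := by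
      rw [← hκpm]
      field_simp
    rw [hpm']
    field_simp
    linear_combination 32 * (x + 1) * hSsq
end

section
/- Let p₀*(κ) = 3(4+κ)²/(32κ) and p_m*(κ) = (m/(8κ(m+1)²))·((m+1)(4+κ)² − 8m − 4√((m+1)(4+κ)² + 4m²)). Then: (a) for every integer m with 1 ≤ m ≤ 3 and every κ > 0, p_m*(κ) ≤ p₀*(κ); (b) for every integer m ≥ 4 and every κ > 0, p_m*(κ) ≤ p₀*(κ) if and only if κ ≤ κ_m := 4(m+3)/(m−3), with equality p_m*(κ) = p₀*(κ) exactly when κ = κ_m. -/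
/-- `p₀*(κ) = 3(4+κ)²/(32κ)`. -/
noncomputable def p0star (κ : ℝ) : ℝ := 3*(4 + κ)^2/(32*κ)

/-- `p_m*(κ) = (m/(8κ(m+1)²))((m+1)(4+κ)² − 8m − 4√((m+1)(4+κ)² + 4m²))`. -/
noncomputable def pmstar (m : ℕ) (κ : ℝ) : ℝ :=
  ((m:ℝ)/(8*κ*((m:ℝ) + 1)^2)) *
    (((m:ℝ) + 1)*(4 + κ)^2 - 8*(m:ℝ)
      - 4*Real.sqrt (((m:ℝ) + 1)*(4 + κ)^2 + 4*(m:ℝ)^2))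

/-- The difference of the two critical points factors in terms of the square root. -/
theorem pmstar_sub_p0star (m : ℕ) {κ : ℝ} (hκ : 0 < κ) :
    pmstar m κ - p0star κ =
      (√(((m:ℝ) + 1)*(4 + κ)^2 + 4*(m:ℝ)^2) + 2*m) / (32*κ*((m:ℝ) + 1)^2) *
        (((m:ℝ) - 3) * √(((m:ℝ) + 1)*(4 + κ)^2 + 4*(m:ℝ)^2) - 2*m*(m + 5)) := by
  have hS : √(((m:ℝ) + 1)*(4 + κ)^2 + 4*(m:ℝ)^2)^2 = ((m:ℝ) + 1)*(4 + κ)^2 + 4*(m:ℝ)^2 :=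
    Real.sq_sqrt (by positivity)
  unfold pmstar p0star
  generalize √(((m:ℝ) + 1)*(4 + κ)^2 + 4*(m:ℝ)^2) = S at hS ⊢
  have hn : (m:ℝ) + 1 ≠ 0 := by positivity
  field_simp
  linear_combination (-8*((m:ℝ) - 3)) * hS

/-- For `m > 3` the difference of the two critical points is a positive multiple of
`κ - 4(m+3)/(m-3)`. -/
theorem exists_pos_pmstar_sub_p0star_eq {m : ℕ} (hm : 3 < m) {κ : ℝ} (hκ : 0 < κ) :
    ∃ c > 0, pmstar m κ - p0star κ = c * (κ - 4*((m:ℝ) + 3)/((m:ℝ) - 3)) := by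
  have hd : 0 < (m:ℝ) - 3 := sub_pos.mpr (by exact_mod_cast hm)
  have hm0 : 0 < (m:ℝ) := by linarith
  have hS : √(((m:ℝ) + 1)*(4 + κ)^2 + 4*(m:ℝ)^2)^2 = ((m:ℝ) + 1)*(4 + κ)^2 + 4*(m:ℝ)^2 :=
    Real.sq_sqrt (by positivity)
  have hS0 := Real.sqrt_nonneg (((m:ℝ) + 1)*(4 + κ)^2 + 4*(m:ℝ)^2)
  rw [pmstar_sub_p0star m hκ]
  generalize √(((m:ℝ) + 1)*(4 + κ)^2 + 4*(m:ℝ)^2) = S at hS hS0 ⊢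
  generalize (m:ℝ) = x at *
  have hT : 0 < (x - 3) * S + 2*x*(x + 5) := by positivity
  refine ⟨(S + 2*x) / (32*κ*(x + 1)^2) *
    ((x + 1) * ((x - 3)*(4 + κ) + 8*x) * (x - 3) / ((x - 3) * S + 2*x*(x + 5))),
    by positivity, ?_⟩
  rw [mul_assoc (_ / _)]
  congr 1
  have hd' := hd.ne'
  rw [div_mul_eq_mul_div, eq_div_iff hT.ne']
  field_simp
  linear_combination (x - 3)^2 * hS

/-- (a) For every integer `1 ≤ m ≤ 3` and every `κ > 0`, `p_m*(κ) ≤ p₀*(κ)`;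
(b) for every integer `m ≥ 4` and every `κ > 0`, `p_m*(κ) ≤ p₀*(κ)` iff
`κ ≤ κ_m = 4(m+3)/(m−3)`, with equality exactly when `κ = κ_m`. -/
theorem stmt11 :
    (∀ m : ℕ, 1 ≤ m → m ≤ 3 → ∀ κ : ℝ, 0 < κ → pmstar m κ ≤ p0star κ) ∧
    (∀ m : ℕ, 4 ≤ m → ∀ κ : ℝ, 0 < κ →
      (pmstar m κ ≤ p0star κ ↔ κ ≤ 4*((m:ℝ) + 3)/((m:ℝ) - 3)) ∧
      (pmstar m κ = p0star κ ↔ κ = 4*((m:ℝ) + 3)/((m:ℝ) - 3))) := by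
  refine ⟨fun m hm hm3 κ hκ => ?_, fun m hm κ hκ => ?_⟩
  · have hd : (m:ℝ) - 3 ≤ 0 := sub_nonpos.mpr (by exact_mod_cast hm3)
    rw [← sub_nonpos, pmstar_sub_p0star m hκ]
    refine mul_nonpos_of_nonneg_of_nonpos (by positivity) (sub_nonpos.mpr ?_)
    exact (mul_nonpos_of_nonpos_of_nonneg hd (Real.sqrt_nonneg _)).trans (by positivity)
  · obtain ⟨c, hc, h⟩ := exists_pos_pmstar_sub_p0star_eq (m := m) (by omega) hκ
    constructor
    · rw [← sub_nonpos, h, mul_nonpos_iff_pos_imp_nonpos, ← sub_nonpos (a := κ)]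
      exact ⟨fun h' => h'.1 hc, fun h' => ⟨fun _ => h', fun _ => hc.le⟩⟩
    · rw [← sub_eq_zero, h, mul_eq_zero, or_iff_right hc.ne', sub_eq_zero]
end

section
/- Let η : ℕ → ℂ satisfy η(0) = 0 and η(k) + k ≠ 0 for every integer k ≥ 1. Define c₁ = 1 and, for n ≥ 2, c_n = ∏_{k=0}^{n−2} (η(k) − k − 2)/(η(k+1) + k + 1). Then for every n ≥ 1, ∑_{j=1}^{n} j·c_j = −(1/2)(η(n) + n)·c_{n+1}. -/
/-- Let `η : ℕ → ℂ` with `η(0) = 0` and `η(k) + k ≠ 0` for `k ≥ 1`. With `c₁ = 1` and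
`c_n = ∏_{k=0}^{n−2} (η(k) − k − 2)/(η(k+1) + k + 1)` for `n ≥ 2` (the expected Taylor
coefficients of the whole-plane Lévy–Loewner map), for every `n ≥ 1`:
`∑_{j=1}^n j c_j = −(1/2)(η(n) + n) c_{n+1}`. -/
theorem stmt13 (η : ℕ → ℂ) (h0 : η 0 = 0) (hnz : ∀ k : ℕ, 1 ≤ k → η k + (k : ℂ) ≠ 0) :
    ∀ n : ℕ, 1 ≤ n →
      ∑ j ∈ Finset.Icc 1 n, (j : ℂ) *
          (∏ k ∈ Finset.range (j - 1), (η k - (k : ℂ) - 2)/(η (k+1) + (k : ℂ) + 1))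
        = -(1/2 : ℂ) * (η n + (n : ℂ)) *
            (∏ k ∈ Finset.range n, (η k - (k : ℂ) - 2)/(η (k+1) + (k : ℂ) + 1)) := by
  intro n _
  induction n with
  | zero => simp [h0]
  | succ n ih =>
    have hn : η (n + 1) + (n : ℂ) + 1 ≠ 0 := by
      simpa [add_assoc] using hnz (n + 1) (Nat.le_add_left 1 n)
    rw [Finset.sum_Icc_succ_top (Nat.le_add_left 1 n), Nat.add_sub_cancel,
      Finset.prod_range_succ]
    rcases Nat.eq_zero_or_pos n with rfl | hpos
    · simp only [Nat.cast_zero, add_zero, zero_add] at hn ⊢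
      simp [h0]
      field_simp
    · rw [ih hpos]
      push_cast
      field_simp
      ring
end
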